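/- Let n ≥ 1 and let α = (α_1, …, α_k) be a composition of n into k positive parts. Then (n+1−k) times the number of ordered pairs (u, v) of n-cycles on [n] such that the product u∘v is α-separated equals (n−1)! · ∏_{i=1}^{k} α_i!. -/

import Mathlib

open Equiv Finset

noncomputable section

/-- The number of cycles of a permutation of `Fin n`, counting fixed points as cycles. -/
def cycleCount {n : ℕ} (σ : Equiv.Perm (Fin n)) : ℕ :=
  σ.cycleType.card + (Finset.univ.filter fun x => σ x = x).card

/-- A permutation of `Fin n` consisting of a single cycle of length `n`
(equivalently, having exactly one cycle, fixed points counting as cycles). -/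
def IsFullCycle {n : ℕ} (σ : Equiv.Perm (Fin n)) : Prop :=
  cycleCount σ = 1

/-- `σ` separates the first `m` elements (`1, …, m`, i.e. indices `0, …, m-1`):
they lie in pairwise distinct cycles of `σ`. -/
def Separates {n : ℕ} (m : ℕ) (σ : Equiv.Perm (Fin n)) : Prop :=
  ∀ i j : Fin n, (i : ℕ) < m → (j : ℕ) < m → i ≠ j → ¬ σ.SameCycle i j

/-- `C_m(N, k)`: the number of permutations of `[N]` with exactly `k` cycles
that separate the first `m` elements. -/
def sepCount (N m k : ℕ) : ℕ :=
  Nat.card {σ : Equiv.Perm (Fin N) // cycleCount σ = k ∧ Separates m σ}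

/-- `C(N, k)`: the signless Stirling number of the first kind, i.e. the number of
permutations of `[N]` with exactly `k` cycles (fixed points counting as cycles). -/
def stirlingCycle (N k : ℕ) : ℕ :=
  Nat.card {σ : Equiv.Perm (Fin N) // cycleCount σ = k}

/-- A permutation `σ` of `Fin n` is `α`-separated for a composition `α` with `k` parts
`α 0, …, α (k-1)`: every cycle of `σ` has all of its elements contained in a single
block `B_i`, where block `B_i` (for `i < k`) consists of the elements with (0-indexed)
values in `[α 0 + ⋯ + α (i-1), α 0 + ⋯ + α i)`. -/
def AlphaSeparated {n : ℕ} (k : ℕ) (α : ℕ → ℕ) (σ : Equiv.Perm (Fin n)) : Prop :=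
  ∀ x y : Fin n, σ.SameCycle x y →
    ∃ i < k, (∑ j ∈ Finset.range i, α j) ≤ (x : ℕ) ∧
      (x : ℕ) < ∑ j ∈ Finset.range (i + 1), α j ∧
      (∑ j ∈ Finset.range i, α j) ≤ (y : ℕ) ∧
      (y : ℕ) < ∑ j ∈ Finset.range (i + 1), α j


section PartOne
variable {X : Type*} [Fintype X] [DecidableEq X]

/-- signed weight of an invariant set. -/
def eS (S : Finset X) (w : Equiv.Perm X) : ℤ :=
  if h : ∀ x, w x ∈ S ↔ x ∈ S then (-1) ^ #S * (Equiv.Perm.sign (w.subtypePerm h) : ℤ) else 0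

/-- transitive permutations. -/
def Trn (w : Equiv.Perm X) : Prop := ∀ x y, w.SameCycle x y

lemma eS_not {S : Finset X} {w : Equiv.Perm X} (h : ¬ ∀ x, w x ∈ S ↔ x ∈ S) : eS S w = 0 := by
  rw [eS, dif_neg h]

lemma eS_eq {S : Finset X} {w : Equiv.Perm X} (h : ∀ x, w x ∈ S ↔ x ∈ S) (g : Equiv.Perm X)
    (h1 : ∀ x ∈ S, g x = w x) (h2 : ∀ x, x ∉ S → g x = x) :
    eS S w = (-1) ^ #S * (Equiv.Perm.sign g : ℤ) := by
  rw [eS, dif_pos h]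
  have hg : ∀ x, g x ∈ S ↔ x ∈ S := by
    intro x
    by_cases hx : x ∈ S
    · rw [h1 x hx]; exact h x
    · rw [h2 x hx]
  have : w.subtypePerm h = g.subtypePerm hg := by
    ext ⟨x, hx⟩
    simp [h1 x hx]
  have h3 : ∀ x, g x ≠ x → x ∈ S := by
    intro x hx
    by_contra hc
    exact hx (h2 x hc)
  rw [this]
  congr 2
  convert Equiv.Perm.sign_subtypePerm g hg h3

/-- the restriction extended by the identity -/
lemma exists_restr {S : Finset X} {w : Equiv.Perm X} (h : ∀ x, w x ∈ S ↔ x ∈ S) :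
    ∃ g : Equiv.Perm X, (∀ x ∈ S, g x = w x) ∧ (∀ x, x ∉ S → g x = x) := by
  refine ⟨Equiv.Perm.ofSubtype (w.subtypePerm h), fun x hx => ?_, fun x hx => ?_⟩
  · rw [Equiv.Perm.ofSubtype_subtypePerm_of_mem h hx]
  · rw [Equiv.Perm.ofSubtype_subtypePerm_of_not_mem h hx]

lemma eS_mul_swap {S : Finset X} (w : Equiv.Perm X) {a b : X} (ha : a ∈ S) (hb : b ∈ S)
    (hab : a ≠ b) : eS S (w * Equiv.swap a b) = - eS S w := by
  have hs : ∀ x, Equiv.swap a b x ∈ S ↔ x ∈ S := by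
    intro x
    rw [Equiv.swap_apply_def]
    split_ifs <;> simp_all
  by_cases h : ∀ x, w x ∈ S ↔ x ∈ S
  · obtain ⟨g, h1, h2⟩ := exists_restr h
    have h' : ∀ x, (w * Equiv.swap a b) x ∈ S ↔ x ∈ S := fun x => by
      rw [Equiv.Perm.mul_apply, h, hs]
    rw [eS_eq h g h1 h2, eS_eq h' (g * Equiv.swap a b)]
    · rw [Equiv.Perm.sign_mul, Equiv.Perm.sign_swap hab]; simp
    · intro x hx
      rw [Equiv.Perm.mul_apply, Equiv.Perm.mul_apply, h1 _ ((hs x).2 hx)]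
    · intro x hx
      have : Equiv.swap a b x = x := by
        apply Equiv.swap_apply_of_ne_of_ne <;> rintro rfl <;> contradiction
      rw [Equiv.Perm.mul_apply, this, h2 x hx]
  · have h' : ¬ ∀ x, (w * Equiv.swap a b) x ∈ S ↔ x ∈ S := by
      intro hc
      apply h
      intro x
      have := hc (Equiv.swap a b x)
      rw [Equiv.Perm.mul_apply, Equiv.swap_apply_self] at this
      rw [this, hs]
    rw [eS_not h, eS_not h', neg_zero]

lemma eS_swap_mul {S : Finset X} (w : Equiv.Perm X) {a b : X} (ha : a ∉ S) (hb : b ∉ S) :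
    eS S (Equiv.swap a b * w) = eS S w := by
  have hs : ∀ x, Equiv.swap a b x ∈ S ↔ x ∈ S := by
    intro x
    rw [Equiv.swap_apply_def]
    split_ifs <;> simp_all
  have hf : ∀ x ∈ S, Equiv.swap a b x = x := by
    intro x hx
    apply Equiv.swap_apply_of_ne_of_ne <;> rintro rfl <;> contradiction
  by_cases h : ∀ x, w x ∈ S ↔ x ∈ S
  · obtain ⟨g, h1, h2⟩ := exists_restr h
    have h' : ∀ x, (Equiv.swap a b * w) x ∈ S ↔ x ∈ S := fun x => by
      rw [Equiv.Perm.mul_apply, hs, h]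
    rw [eS_eq h g h1 h2, eS_eq h' g]
    · intro x hx
      rw [Equiv.Perm.mul_apply, hf _ ((h x).2 hx), h1 x hx]
    · exact h2
  · have h' : ¬ ∀ x, (Equiv.swap a b * w) x ∈ S ↔ x ∈ S := by
      intro hc
      apply h
      intro x
      rw [← hc x, Equiv.Perm.mul_apply, hs]
    rw [eS_not h, eS_not h']

lemma eS_union {S O : Finset X} {w : Equiv.Perm X} (h : ∀ x, w x ∈ S ↔ x ∈ S)
    (h' : ∀ x, w x ∈ O ↔ x ∈ O) (hd : Disjoint S O) : eS (S ∪ O) w = eS S w * eS O w := by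
  obtain ⟨g, h1, h2⟩ := exists_restr h
  obtain ⟨g', h1', h2'⟩ := exists_restr h'
  have hd' : ∀ x ∈ S, x ∉ O := fun x hx hx' => Finset.disjoint_left.1 hd hx hx'
  have hu : ∀ x, w x ∈ S ∪ O ↔ x ∈ S ∪ O := fun x => by
    rw [mem_union, mem_union, h, h']
  rw [eS_eq h g h1 h2, eS_eq h' g' h1' h2', eS_eq hu (g * g')]
  · rw [card_union_of_disjoint hd, Equiv.Perm.sign_mul]
    push_cast; ring
  · intro x hx
    rw [Equiv.Perm.mul_apply]
    by_cases hxO : x ∈ O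
    · rw [h1' x hxO, h2]
      intro hc
      exact hd' _ hc ((h' x).2 hxO)
    · rw [h2' x hxO, h1]
      simpa [hxO] using hx
  · intro x hx
    rw [mem_union, not_or] at hx
    rw [Equiv.Perm.mul_apply, h2' x hx.2, h2 x hx.1]

lemma eS_orbit {S : Finset X} {w : Equiv.Perm X} (y : X) (h : ∀ x, x ∈ S ↔ w.SameCycle y x) :
    eS S w = -1 := by
  classical
  have hi : ∀ x, w x ∈ S ↔ x ∈ S := fun x => by
    rw [h, h, Equiv.Perm.sameCycle_apply_right]
  have hg : eS S w = (-1) ^ #S * (Equiv.Perm.sign (w.cycleOf y) : ℤ) := by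
    apply eS_eq hi
    · intro x hx
      exact ((h x).1 hx).cycleOf_apply
    · intro x hx
      exact Equiv.Perm.cycleOf_apply_of_not_sameCycle (fun hc => hx ((h x).2 hc))
  rw [hg]
  by_cases hy : w y = y
  · rw [(Equiv.Perm.cycleOf_eq_one_iff w).2 hy]
    have : S = {y} := by
      ext x
      rw [h, mem_singleton]
      constructor
      · intro hc; exact (hc.eq_of_left hy).symm
      · rintro rfl; exact Equiv.Perm.SameCycle.refl _ _
    rw [this]; simp
  · rw [(Equiv.Perm.isCycle_cycleOf w hy).sign]
    have : (w.cycleOf y).support = S := by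
      ext x
      rw [h, Equiv.Perm.mem_support_cycleOf_iff' hy]
    rw [this]
    push_cast
    rw [mul_neg, ← pow_add, ← two_mul, pow_mul]; simp

lemma eS_empty (w : Equiv.Perm X) : eS ∅ w = 1 := by
  rw [eS_eq (by simp) 1 (by simp) (by simp)]
  simp

lemma trn_sub {w : Equiv.Perm X} (hw : Trn w) {S : Finset X} (h : ∀ x, w x ∈ S ↔ x ∈ S)
    {y : X} (hy : y ∈ S) : S = univ := by
  ext x
  simp only [mem_univ, iff_true]
  obtain ⟨i, hi⟩ := (hw y x).exists_nat_pow_eq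
  rw [← hi]
  clear hi
  induction i with
  | zero => simpa
  | succ i ih => rw [pow_succ', Equiv.Perm.mul_apply, h]; exact ih

lemma eS_sum_avoid (w : Equiv.Perm X) (x0 : X) [Decidable (Trn w)] :
    ∑ S ∈ univ.filter (fun S : Finset X => x0 ∉ S), eS S w = if Trn w then 1 else 0 := by
  classical
  split_ifs with hw
  · rw [Finset.sum_eq_single ∅]
    · exact eS_empty w
    · intro S hS hne
      rw [eS_not]
      intro h
      obtain ⟨y, hy⟩ := Finset.nonempty_iff_ne_empty.2 hne
      have := trn_sub hw h hy
      subst this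
      simp at hS
    · simp
  · have : ∃ y, ¬ w.SameCycle x0 y := by
      by_contra! hc
      exact hw fun x y => (hc x).symm.trans (hc y)
    obtain ⟨y, hy⟩ := this
    set O : Finset X := univ.filter (fun x => w.SameCycle y x) with hO
    have hOm : ∀ x, x ∈ O ↔ w.SameCycle y x := fun x => by simp [hO]
    have hOi : ∀ x, w x ∈ O ↔ x ∈ O := fun x => by
      rw [hOm, hOm, Equiv.Perm.sameCycle_apply_right]
    have h0 : x0 ∉ O := by rw [hOm]; exact fun h => hy h.symm
    have hyO : y ∈ O := by rw [hOm]
    have key : ∀ S : Finset X, (∀ x, w x ∈ S ↔ x ∈ S) → y ∉ S → Disjoint S O := by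
      intro S hS hyS
      rw [Finset.disjoint_left]
      intro x hx hxO
      rw [hOm] at hxO
      obtain ⟨i, hi⟩ := hxO.symm.exists_nat_pow_eq
      apply hyS
      rw [← hi]
      clear hi
      induction i with
      | zero => simpa
      | succ i ih => rw [pow_succ', Equiv.Perm.mul_apply, hS]; exact ih
    have key2 : ∀ S : Finset X, (∀ x, w x ∈ S ↔ x ∈ S) → y ∈ S → O ⊆ S := by
      intro S hS hyS x hxO
      rw [hOm] at hxO
      obtain ⟨i, hi⟩ := hxO.exists_nat_pow_eq
      rw [← hi]
      clear hi
      induction i with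
      | zero => simpa
      | succ i ih => rw [pow_succ', Equiv.Perm.mul_apply, hS]; exact ih
    rw [← Finset.sum_filter_of_ne (p := fun S => ∀ x, w x ∈ S ↔ x ∈ S)]
    swap
    · intro S _ hne
      by_contra hc
      exact hne (eS_not hc)
    refine Finset.sum_involution (fun S _ => if y ∈ S then S \ O else S ∪ O) ?_ ?_ ?_ ?_
    · intro S hS
      simp only [mem_filter, mem_univ, true_and] at hS
      split_ifs with hyS
      · have hsub := key2 S hS.2 hyS
        have e1 : eS ((S \ O) ∪ O) w = eS (S \ O) w * eS O w := by
          apply eS_union _ hOi Finset.sdiff_disjoint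
          intro x
          rw [mem_sdiff, mem_sdiff, hS.2, hOi]
        rw [Finset.sdiff_union_of_subset hsub, eS_orbit y hOm] at e1
        rw [e1]; ring
      · rw [eS_union hS.2 hOi (key S hS.2 hyS), eS_orbit y hOm]; ring
    · intro S hS _
      split_ifs with hyS
      · intro hc
        rw [← hc] at hyS
        simp [hyO] at hyS
      · intro hc
        apply hyS
        rw [← hc]; simp [hyO]
    · intro S hS
      simp only [mem_filter, mem_univ, true_and] at hS ⊢
      split_ifs with hyS
      · refine ⟨by simp [hS.1], fun x => ?_⟩
        rw [mem_sdiff, mem_sdiff, hS.2, hOi]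
      · refine ⟨by simp [hS.1, h0], fun x => ?_⟩
        rw [mem_union, mem_union, hS.2, hOi]
    · intro S hS
      simp only [mem_filter, mem_univ, true_and] at hS
      by_cases hyS : y ∈ S
      · rw [if_pos hyS, if_neg (by simp [hyO]), Finset.sdiff_union_of_subset (key2 S hS.2 hyS)]
      · rw [if_neg hyS, if_pos (by simp [hyO]), Finset.union_sdiff_cancel_right (key S hS.2 hyS)]

lemma eS_sum (w : Equiv.Perm X) [Decidable (Trn w)] :
    ∑ S : Finset X, ((Fintype.card X : ℤ) - #S) * eS S w =
      if Trn w then (Fintype.card X : ℤ) else 0 := by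
  have h1 : ∀ S : Finset X, ((Fintype.card X : ℤ) - #S) * eS S w =
      ∑ x0 : X, if x0 ∉ S then eS S w else 0 := by
    intro S
    rw [← Finset.sum_filter, Finset.sum_const, nsmul_eq_mul]
    congr 1
    have : univ.filter (fun x => x ∉ S) = Sᶜ := by ext; simp
    rw [this, Finset.card_compl, Nat.cast_sub (Finset.card_le_univ S)]
  rw [Finset.sum_congr rfl (fun S _ => h1 S), Finset.sum_comm]
  simp_rw [← Finset.sum_filter, eS_sum_avoid]
  split_ifs <;> simp

end PartOne

section PartTwo

lemma trn_isCycle {X : Type*} [Fintype X] [DecidableEq X] [Nontrivial X] {w : Equiv.Perm X}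
    (h : Trn w) : w.IsCycle ∧ w.support = univ := by
  have hne : ∀ x, w x ≠ x := by
    intro x hx
    obtain ⟨y, hy⟩ := exists_ne x
    exact hy ((h x y).eq_of_left hx).symm
  refine ⟨?_, ?_⟩
  · obtain ⟨x⟩ : Nonempty X := inferInstance
    exact ⟨x, hne x, fun y _ => h x y⟩
  · ext x; simp [hne x]

lemma trn_of_isCycle {X : Type*} {w : Equiv.Perm X}
    (h : w.IsCycle) (h2 : ∀ x, w x ≠ x) : Trn w :=
  fun x y => h.sameCycle (h2 x) (h2 y)

lemma card_trn (X : Type*) [Fintype X] [Nonempty X] :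
    Nat.card {w : Equiv.Perm X // Trn w} = (Fintype.card X - 1).factorial := by
  classical
  rcases subsingleton_or_nontrivial X with hX | hX
  · have : ∀ w : Equiv.Perm X, Trn w := fun w x y => by
      rw [Subsingleton.elim x y]
    have hc : Fintype.card X = 1 := le_antisymm
      (Fintype.card_le_one_iff_subsingleton.2 hX) Fintype.card_pos
    rw [Nat.card_congr (Equiv.subtypeUnivEquiv this), Nat.card_eq_fintype_card,
      Fintype.card_perm, hc]
    rfl
  · have h2 : 2 ≤ Fintype.card X := Fintype.one_lt_card
    have := Equiv.Perm.card_of_cycleType_singleton (α := X) h2 le_rfl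
    rw [Nat.choose_self, mul_one] at this
    rw [← this, Nat.card_eq_fintype_card, Fintype.card_subtype]
    congr 1
    ext w
    simp only [mem_filter, mem_univ, true_and]
    constructor
    · intro h
      obtain ⟨h1, h3⟩ := trn_isCycle h
      rw [h1.cycleType, h3, card_univ]
    · intro h
      have h1 : w.IsCycle := by
        rw [← Equiv.Perm.card_cycleType_eq_one, h]; simp
      apply trn_of_isCycle h1
      rw [h1.cycleType, Multiset.singleton_inj] at h
      have := Finset.eq_univ_of_card _ h
      intro x
      rw [← Equiv.Perm.mem_support, this]; simp

lemma isFullCycle_iff {n : ℕ} (hn : 1 ≤ n) (σ : Equiv.Perm (Fin n)) : IsFullCycle σ ↔ Trn σ := by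
  unfold IsFullCycle cycleCount
  constructor
  · intro h
    rcases Nat.eq_zero_or_pos (univ.filter fun x => σ x = x).card with h0 | h0
    · rw [h0, add_zero, Equiv.Perm.card_cycleType_eq_one] at h
      apply trn_of_isCycle h
      intro x hx
      rw [card_eq_zero] at h0
      have : x ∈ (univ.filter fun x => σ x = x) := by simp [hx]
      rw [h0] at this
      simp at this
    · have h1 : σ.cycleType.card = 0 := by omega
      rw [Multiset.card_eq_zero, Equiv.Perm.cycleType_eq_zero] at h1
      subst h1
      simp at h
      subst h
      intro x y
      rw [Subsingleton.elim x y]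
  · intro h
    rcases hn.eq_or_lt with h1 | h1
    · subst h1
      have : σ = 1 := Subsingleton.elim _ _
      subst this
      simp
    · have : Nontrivial (Fin n) := Fin.nontrivial_iff_two_le.2 h1
      obtain ⟨h2, h3⟩ := trn_isCycle h
      rw [Equiv.Perm.card_cycleType_eq_one.2 h2]
      simp only [Nat.add_eq_left, card_eq_zero]
      ext x
      have : x ∈ σ.support := by rw [h3]; simp
      simpa using this

variable {X : Type*} [Fintype X] [DecidableEq X]

lemma trn_swap_iff {T : Finset X} {a b : X} (ha : a ∉ T) (hb : b ∈ T) (u : Equiv.Perm X) :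
    (Trn u ∧ ∀ x, u x ∈ insert a (T.erase b) ↔ x ∈ T) ↔
    ((∀ x, (Equiv.swap a b * u) x ∈ T ↔ x ∈ T) ∧
      (∀ x ∈ T, (Equiv.swap a b * u).SameCycle b x) ∧
      (∀ x, x ∉ T → (Equiv.swap a b * u).SameCycle a x)) := by
  have hab : a ≠ b := by rintro rfl; contradiction
  have h0 : ∀ y, Equiv.swap a b y ∈ T ↔ y ∈ insert a (T.erase b) := by
    intro y
    rw [Equiv.swap_apply_def]
    split_ifs with h1 h2
    · simp [h1, hb]
    · simp [h2, ha, hab.symm]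
    · simp [h1, h2]
  have h0' : (∀ x, (Equiv.swap a b * u) x ∈ T ↔ x ∈ T) ↔
      ∀ x, u x ∈ insert a (T.erase b) ↔ x ∈ T := by
    simp only [Equiv.Perm.mul_apply, h0]
  rw [← h0', and_comm]
  refine and_congr_right fun hv => ?_
  set v := Equiv.swap a b * u with hvdef
  have huv : ∀ x, u x = Equiv.swap a b (v x) := by intro x; simp [hvdef]
  have huv' : ∀ x, u x ≠ a → u x ≠ b → v x = u x := by
    intro x h1 h2
    rw [hvdef, Equiv.Perm.mul_apply, Equiv.swap_apply_of_ne_of_ne h1 h2]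
  constructor
  · intro hu
    have key : ∀ y, (y ∈ T ∧ v.SameCycle b y) ∨ (y ∉ T ∧ v.SameCycle a y) := by
      intro y
      obtain ⟨i, hi⟩ := (hu b y).exists_nat_pow_eq
      rw [← hi]
      clear hi
      induction i with
      | zero => left; exact ⟨by simpa using hb, Equiv.Perm.SameCycle.refl _ _⟩
      | succ i ih =>
        rw [pow_succ', Equiv.Perm.mul_apply]
        by_cases h1 : u ((u ^ i) b) = a
        · rw [h1]; right; exact ⟨ha, Equiv.Perm.SameCycle.refl _ _⟩
        by_cases h2 : u ((u ^ i) b) = b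
        · rw [h2]; left; exact ⟨hb, Equiv.Perm.SameCycle.refl _ _⟩
        rw [← huv' _ h1 h2, Equiv.Perm.sameCycle_apply_right, Equiv.Perm.sameCycle_apply_right, hv]
        exact ih
    constructor
    · intro x hx
      rcases key x with h | h
      · exact h.2
      · exact absurd hx h.1
    · intro x hx
      rcases key x with h | h
      · exact absurd h.1 hx
      · exact h.2
  · rintro ⟨h1, h2⟩
    have k1 : ∀ x ∈ T, u.SameCycle b x := by
      intro x hx
      obtain ⟨i, hi⟩ := (h1 x hx).exists_nat_pow_eq
      rw [← hi]
      clear hi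
      have hm : ∀ i : ℕ, (v ^ i) b ∈ T := by
        intro i
        induction i with
        | zero => simpa using hb
        | succ i ih => rw [pow_succ', Equiv.Perm.mul_apply, hv]; exact ih
      induction i with
      | zero => exact Equiv.Perm.SameCycle.refl _ _
      | succ i ih =>
        have hm' := hm (i + 1)
        rw [pow_succ', Equiv.Perm.mul_apply] at hm' ⊢
        by_cases h3 : v ((v ^ i) b) = b
        · rw [h3]
        · have : u ((v ^ i) b) = v ((v ^ i) b) := by
            rw [huv, Equiv.swap_apply_of_ne_of_ne _ h3]
            intro hc
            rw [hc] at hm'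
            exact ha hm'
          rw [← this, Equiv.Perm.sameCycle_apply_right]
          exact ih
    have k2 : ∀ x, x ∉ T → u.SameCycle a x := by
      intro x hx
      obtain ⟨i, hi⟩ := (h2 x hx).exists_nat_pow_eq
      rw [← hi]
      clear hi
      have hm : ∀ i : ℕ, (v ^ i) a ∉ T := by
        intro i
        induction i with
        | zero => simpa using ha
        | succ i ih => rw [pow_succ', Equiv.Perm.mul_apply, hv]; exact ih
      induction i with
      | zero => exact Equiv.Perm.SameCycle.refl _ _
      | succ i ih =>
        have hm' := hm (i + 1)
        rw [pow_succ', Equiv.Perm.mul_apply] at hm' ⊢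
        by_cases h3 : v ((v ^ i) a) = a
        · rw [h3]
        · have : u ((v ^ i) a) = v ((v ^ i) a) := by
            rw [huv, Equiv.swap_apply_of_ne_of_ne h3]
            intro hc
            rw [hc] at hm'
            exact hm' hb
          rw [← this, Equiv.Perm.sameCycle_apply_right]
          exact ih
    have k3 : u.SameCycle b a := by
      have e1 : v (v⁻¹ b) = b := by simp
      have e2 : u (v⁻¹ b) = a := by rw [huv, e1, Equiv.swap_apply_right]
      rw [← e2, Equiv.Perm.sameCycle_apply_right]
      apply k1
      rw [← hv, e1]; exact hb
    have k4 : ∀ x, u.SameCycle b x := by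
      intro x
      by_cases hx : x ∈ T
      · exact k1 x hx
      · exact k3.trans (k2 x hx)
    exact fun x y => (k4 x).symm.trans (k4 y)

/-- permutations transitive on both sides of `T` -/
def splitEquiv {T : Finset X} {a b : X} (ha : a ∉ T) (hb : b ∈ T) :
    {v : Equiv.Perm X // (∀ x, v x ∈ T ↔ x ∈ T) ∧ (∀ x ∈ T, v.SameCycle b x) ∧
      (∀ x, x ∉ T → v.SameCycle a x)} ≃
    {p : Equiv.Perm {x // x ∈ T} // Trn p} × {p : Equiv.Perm {x // x ∉ T} // Trn p} where
  toFun v := ⟨⟨v.1.subtypePerm v.2.1, fun x y => by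
      rw [Equiv.Perm.sameCycle_subtypePerm]
      exact (v.2.2.1 x x.2).symm.trans (v.2.2.1 y y.2)⟩,
    ⟨v.1.subtypePerm (fun x => not_congr (v.2.1 x)), fun x y => by
      rw [Equiv.Perm.sameCycle_subtypePerm]
      exact (v.2.2.2 x x.2).symm.trans (v.2.2.2 y y.2)⟩⟩
  invFun p := ⟨p.1.1.subtypeCongr p.2.1, by
    have h1 : ∀ x, (p.1.1.subtypeCongr p.2.1) x ∈ T ↔ x ∈ T := by
      intro x
      by_cases hx : x ∈ T
      · rw [Equiv.Perm.subtypeCongr.left_apply _ _ hx]; simp [hx]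
      · rw [Equiv.Perm.subtypeCongr.right_apply _ _ hx]
        simp only [hx, iff_false]
        exact (p.2.1 ⟨x, hx⟩).2
    refine ⟨h1, fun x hx => ?_, fun x hx => ?_⟩
    · have h2 : (p.1.1.subtypeCongr p.2.1).subtypePerm h1 = p.1.1 := by
        ext x; simp
      have h3 := p.1.2 ⟨b, hb⟩ ⟨x, hx⟩
      rw [← h2, Equiv.Perm.sameCycle_subtypePerm] at h3
      exact h3
    · have h2 : (p.1.1.subtypeCongr p.2.1).subtypePerm (fun x => not_congr (h1 x)) = p.2.1 := by
        ext x; simp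
      have h3 := p.2.2 ⟨a, ha⟩ ⟨x, hx⟩
      rw [← h2, Equiv.Perm.sameCycle_subtypePerm] at h3
      exact h3⟩
  left_inv v := by
    ext x
    by_cases hx : x ∈ T <;> simp [hx]
  right_inv p := by
    ext x <;> simp

lemma count_u {T : Finset X} {a b : X} (ha : a ∉ T) (hb : b ∈ T) :
    Nat.card {u : Equiv.Perm X // Trn u ∧ ∀ x, u x ∈ insert a (T.erase b) ↔ x ∈ T} =
      (#T - 1).factorial * (Fintype.card X - #T - 1).factorial := by
  rw [Nat.card_congr ((Equiv.subtypeEquiv (Equiv.mulLeft (Equiv.swap a b))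
    (fun u => trn_swap_iff ha hb u)).trans (splitEquiv ha hb)), Nat.card_prod]
  have : Nonempty {x // x ∈ T} := ⟨⟨b, hb⟩⟩
  have : Nonempty {x // x ∉ T} := ⟨⟨a, ha⟩⟩
  rw [card_trn, card_trn]
  congr 3
  · simp
  · rw [Fintype.card_subtype_compl]; simp

end PartTwo

section PartThree
variable {X : Type*} [Fintype X] [DecidableEq X] {K : Type*}

lemma trn_sub' {w : Equiv.Perm X} (hw : Trn w) {S : Finset X} (h : ∀ x ∈ S, w x ∈ S)
    {y : X} (hy : y ∈ S) : S = univ := by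
  ext x
  simp only [mem_univ, iff_true]
  obtain ⟨i, hi⟩ := (hw y x).exists_nat_pow_eq
  rw [← hi]
  clear hi
  induction i with
  | zero => simpa
  | succ i ih => rw [pow_succ', Equiv.Perm.mul_apply]; exact h _ ih

lemma trn_conj {u : Equiv.Perm X} (hu : Trn u) (g : Equiv.Perm X) : Trn (g * u * g⁻¹) := by
  intro x y
  rw [Equiv.Perm.sameCycle_conj]
  exact hu _ _

lemma inv_mem {w : Equiv.Perm X} {S : Finset X} (h : ∀ x, w x ∈ S ↔ x ∈ S) {x y : X}
    (hxy : w.SameCycle x y) (hx : x ∈ S) : y ∈ S := by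
  obtain ⟨i, hi⟩ := hxy.exists_nat_pow_eq
  rw [← hi]
  clear hi
  induction i with
  | zero => simpa
  | succ i ih => rw [pow_succ', Equiv.Perm.mul_apply, h]; exact ih

lemma G_zero [DecidablePred (Trn : Equiv.Perm X → Prop)] {S : Finset X} {h : Equiv.Perm X}
    (hne : S.Nonempty) (hnu : S ≠ univ) (hfix : ∀ x ∈ S, h x = x) :
    ∑ u ∈ univ.filter (fun u : Equiv.Perm X => Trn u), eS S (u * h) = 0 := by
  apply Finset.sum_eq_zero
  intro u hu
  simp only [mem_filter, mem_univ, true_and] at hu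
  apply eS_not
  intro hi
  obtain ⟨y, hy⟩ := hne
  apply hnu
  apply trn_sub' hu _ hy
  intro x hx
  have := hi x
  rw [Equiv.Perm.mul_apply, hfix x hx] at this
  exact this.2 hx

lemma G_two [DecidablePred (Trn : Equiv.Perm X → Prop)] {S : Finset X} {h : Equiv.Perm X}
    {p q : X} (hp : p ∈ S) (hq : q ∈ S) (hpq : p ≠ q) (hp' : h p ∉ S) (hq' : h q ∉ S) :
    ∑ u ∈ univ.filter (fun u : Equiv.Perm X => Trn u), eS S (u * h) = 0 := by
  have : ∑ u ∈ univ.filter (fun u : Equiv.Perm X => Trn u), eS S (u * h) =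
      ∑ u ∈ univ.filter (fun u : Equiv.Perm X => Trn u), - eS S (u * h) := by
    have hinv : ∀ u : Equiv.Perm X, Equiv.swap (h p) (h q) *
        (Equiv.swap (h p) (h q) * u * (Equiv.swap (h p) (h q))⁻¹) *
        (Equiv.swap (h p) (h q))⁻¹ = u := by
      intro u
      rw [Equiv.swap_inv, mul_assoc, mul_assoc, mul_assoc, Equiv.swap_mul_self, mul_one,
        ← mul_assoc, Equiv.swap_mul_self, one_mul]
    refine Finset.sum_bij' (fun u _ => Equiv.swap (h p) (h q) * u * (Equiv.swap (h p) (h q))⁻¹)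
      (fun u _ => Equiv.swap (h p) (h q) * u * (Equiv.swap (h p) (h q))⁻¹) ?_ ?_ ?_ ?_ ?_
    · intro u hu
      simp only [mem_filter, mem_univ, true_and] at hu ⊢
      exact trn_conj hu _
    · intro u hu
      simp only [mem_filter, mem_univ, true_and] at hu ⊢
      exact trn_conj hu _
    · intro u _; exact hinv u
    · intro u _; exact hinv u
    · intro u _
      rw [Equiv.swap_inv, mul_assoc, mul_assoc, eS_swap_mul _ hp' hq',
        ← Equiv.mul_swap_eq_swap_mul, ← mul_assoc, eS_mul_swap _ hp hq hpq, neg_neg]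
  rw [Finset.sum_neg_distrib] at this
  linarith

lemma G_one [DecidablePred (Trn : Equiv.Perm X → Prop)] {S : Finset X} {h : Equiv.Perm X}
    {p : X} (hp : p ∈ S) (hp' : h p ∉ S) (hfix : ∀ x ∈ S, x ≠ p → h x = x) :
    ∑ u ∈ univ.filter (fun u : Equiv.Perm X => Trn u), eS S (u * h) =
      - (((#S - 1).factorial * (Fintype.card X - #S - 1).factorial : ℕ) : ℤ) := by
  classical
  set T : Finset X := insert (h p) (S.erase p) with hT
  have hpT : p ∉ T := by
    rw [hT, mem_insert, not_or]
    exact ⟨fun hc => hp' (hc ▸ hp), by simp⟩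
  have hbT : h p ∈ T := by simp [hT]
  have hTc : #T = #S := by
    rw [hT, card_insert_of_notMem (by simp [hp']), card_erase_of_mem hp]
    have := Finset.card_pos.2 ⟨p, hp⟩
    omega
  have hST : insert p (T.erase (h p)) = S := by
    rw [hT, erase_insert (by simp [hp']), insert_erase hp]
  have hTS : ∀ x, h x ∈ T ↔ x ∈ S := by
    have hTi : T = S.image h := by
      ext y
      simp only [hT, mem_insert, mem_erase, mem_image]
      constructor
      · rintro (rfl | ⟨h1, h2⟩)
        · exact ⟨p, hp, rfl⟩
        · exact ⟨y, h2, hfix y h2 h1⟩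
      · rintro ⟨x, hx, rfl⟩
        by_cases hxp : x = p
        · left; rw [hxp]
        · right; rw [hfix x hx hxp]; exact ⟨hxp, hx⟩
    intro x
    rw [hTi, Finset.mem_image]
    constructor
    · rintro ⟨y, hy, hyx⟩
      rwa [← h.injective hyx]
    · intro hx; exact ⟨x, hx, rfl⟩
  have hinv : ∀ u : Equiv.Perm X, (∀ x, (u * h) x ∈ S ↔ x ∈ S) ↔
      ∀ x, u x ∈ insert p (T.erase (h p)) ↔ x ∈ T := by
    intro u
    rw [hST]
    constructor
    · intro hi x
      have h1 := hi (h⁻¹ x)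
      have h2 := hTS (h⁻¹ x)
      rw [Equiv.Perm.mul_apply] at h1
      have e0 : h (h⁻¹ x) = x := by simp
      rw [e0] at h1 h2
      rw [h1, h2]
    · intro hi x
      rw [Equiv.Perm.mul_apply, hi, hTS]
  rw [← hTc, ← count_u hpT hbT, Nat.card_eq_fintype_card, Fintype.card_subtype,
    ← Finset.filter_filter]
  rw [← Finset.sum_filter_of_ne (p := fun u : Equiv.Perm X =>
    ∀ x, u x ∈ insert p (T.erase (h p)) ↔ x ∈ T)]
  · rw [Finset.sum_congr rfl (g := fun _ => (-1 : ℤ))]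
    · simp
    · intro u hu
      simp only [mem_filter, mem_univ, true_and] at hu
      obtain ⟨hu, hi⟩ := hu
      rw [← hinv] at hi
      apply eS_orbit p
      intro x
      constructor
      · intro hx
        by_contra hc
        set Q : Finset X := univ.filter (fun y => (u * h).SameCycle x y) with hQ
        have hQm : ∀ y, y ∈ Q ↔ (u * h).SameCycle x y := fun y => by simp [hQ]
        have hpQ : p ∉ Q := by rw [hQm]; exact fun h => hc h.symm
        have : Q = univ := by
          apply trn_sub' hu (y := x)
          · intro y hy
            have hyS : y ∈ S := inv_mem hi ((hQm y).1 hy) hx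
            have hyp : y ≠ p := fun h => hpQ (h ▸ hy)
            have e1 : (u * h) y = u y := by rw [Equiv.Perm.mul_apply, hfix y hyS hyp]
            rw [← e1, hQm, Equiv.Perm.sameCycle_apply_right, ← hQm]
            exact hy
          · rw [hQm]
        rw [this] at hpQ
        exact hpQ (mem_univ _)
      · intro hx
        exact inv_mem hi hx hp
  · intro u _ hne
    rw [← hinv]
    by_contra hc
    exact hne (eS_not hc)

lemma G_eq [DecidablePred (Trn : Equiv.Perm X → Prop)] {S : Finset X} {h : Equiv.Perm X}
    {f : X → K} (hne : S.Nonempty) (hinj : Set.InjOn f S) (hf : f ∘ h = f) :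
    ((Fintype.card X : ℤ) - #S) *
      ∑ u ∈ univ.filter (fun u : Equiv.Perm X => Trn u), eS S (u * h) =
    - (if #(S.filter fun x => h x ≠ x) = 1 then
      (((#S - 1).factorial * (Fintype.card X - #S).factorial : ℕ) : ℤ) else 0) := by
  have hmv : ∀ x ∈ S, h x ∈ S → h x = x := by
    intro x hx hhx
    exact hinj hhx hx (congrFun hf x)
  rcases Nat.lt_trichotomy (#(S.filter fun x => h x ≠ x)) 1 with h0 | h1 | h2
  · rw [if_neg (by omega)]
    have h0' : #(S.filter fun x => h x ≠ x) = 0 := by omega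
    rw [card_eq_zero, filter_eq_empty_iff] at h0'
    by_cases hnu : S = univ
    · subst hnu; simp
    · rw [G_zero hne hnu (fun x hx => not_not.1 (h0' hx))]; simp
  · rw [if_pos h1]
    rw [card_eq_one] at h1
    obtain ⟨p, hp⟩ := h1
    have hpm : ∀ x, x ∈ S ∧ h x ≠ x ↔ x = p := by
      intro x
      rw [← mem_singleton, ← hp, mem_filter]
    have hpS := ((hpm p).2 rfl)
    have hp' : h p ∉ S := fun hc => hpS.2 (hmv p hpS.1 hc)
    rw [G_one hpS.1 hp']
    · have hlt : #S < Fintype.card X := by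
        rw [← card_univ]
        apply Finset.card_lt_card
        rw [Finset.ssubset_univ_iff]
        intro hc
        rw [hc] at hp'
        exact hp' (mem_univ _)
      obtain ⟨d, hd⟩ := Nat.exists_eq_add_of_lt hlt
      rw [hd]
      have e1 : #S + d + 1 - #S = d + 1 := by omega
      rw [e1, Nat.factorial_succ]
      push_cast
      ring
    · intro x hx hxp
      by_contra hc
      exact hxp ((hpm x).1 ⟨hx, hc⟩)
  · rw [if_neg (by omega)]
    obtain ⟨p, hp, q, hq, hpq⟩ := Finset.one_lt_card.1 h2
    rw [mem_filter] at hp hq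
    rw [G_two hp.1 hq.1 hpq (fun hc => hp.2 (hmv p hp.1 hc)) (fun hc => hq.2 (hmv q hq.1 hc))]
    simp

end PartThree

section PartFour
variable {X : Type*} [Fintype X] [DecidableEq X] {K : Type*} [Fintype K] [DecidableEq K]

/-- fibre sizes -/
def fib (f : X → K) (i : K) : ℕ := #(univ.filter fun x => f x = i)

/-- number of block permutations fixing `R` pointwise -/
def FR (f : X → K) (R : Finset X) : ℕ :=
  #(univ.filter fun h : Equiv.Perm X => f ∘ h = f ∧ ∀ x ∈ R, h x = x)

lemma FR_mul (f : X → K) (R : Finset X) (hinj : Set.InjOn f R) :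
    FR f R * ∏ x ∈ R, fib f (f x) = ∏ i, (fib f i).factorial := by
  set f' : X → K ⊕ X := fun x => if x ∈ R then Sum.inr x else Sum.inl (f x) with hf'
  have hR : ∀ x, x ∈ R → f' x = Sum.inr x := fun x hx => by simp [hf', hx]
  have hnR : ∀ x, x ∉ R → f' x = Sum.inl (f x) := fun x hx => by simp [hf', hx]
  have h1 : ∀ h : Equiv.Perm X, (f ∘ h = f ∧ ∀ x ∈ R, h x = x) ↔ f' ∘ h = f' := by
    intro h
    constructor
    · rintro ⟨e1, e2⟩
      funext x
      rw [Function.comp_apply]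
      by_cases hx : x ∈ R
      · rw [e2 x hx]
      · have : h x ∉ R := by
          intro hc
          have := h.injective (e2 _ hc)
          rw [this] at hc
          exact hx hc
        rw [hnR _ this, hnR _ hx]
        congr 1
        exact congrFun e1 x
    · intro e
      have e3 : ∀ x ∈ R, h x = x := by
        intro x hx
        have := congrFun e x
        rw [Function.comp_apply, hR x hx] at this
        by_cases hhx : h x ∈ R
        · rw [hR _ hhx] at this
          exact Sum.inr_injective this
        · rw [hnR _ hhx] at this
          simp at this
      refine ⟨?_, e3⟩
      funext x
      rw [Function.comp_apply]
      by_cases hx : x ∈ R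
      · rw [e3 x hx]
      · have := congrFun e x
        rw [Function.comp_apply, hnR x hx] at this
        by_cases hhx : h x ∈ R
        · rw [hR _ hhx] at this
          simp at this
        · rw [hnR _ hhx] at this
          exact Sum.inl_injective this
  have h2 : FR f R = ∏ i, (#(univ.filter fun x => f' x = i)).factorial := by
    have := DomMulAct.stabilizer_card f'
    simp only [Fintype.card_subtype] at this
    rw [← this, FR]
    congr 1
    ext h
    simp only [mem_filter, mem_univ, true_and]
    exact h1 h
  rw [h2, Fintype.prod_sum_type]
  have h3 : ∏ x : X, (#(univ.filter fun y => f' y = Sum.inr x)).factorial = 1 := by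
    apply Finset.prod_eq_one
    intro x _
    rw [Nat.factorial_eq_one, Finset.card_le_one]
    intro y hy z hz
    simp only [mem_filter, mem_univ, true_and] at hy hz
    have key : ∀ y, f' y = Sum.inr x → y = x := by
      intro y hy
      by_cases hyR : y ∈ R
      · rw [hR y hyR] at hy; exact Sum.inr_injective hy
      · rw [hnR y hyR] at hy; simp at hy
    rw [key y hy, key z hz]
  rw [h3, mul_one]
  have h4 : ∏ x ∈ R, fib f (f x) = ∏ i, if i ∈ R.image f then fib f i else 1 := by
    rw [Finset.prod_ite_mem, Finset.univ_inter, Finset.prod_image hinj]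
  rw [h4, ← Finset.prod_mul_distrib]
  apply Finset.prod_congr rfl
  intro i _
  have h5 : (univ.filter fun y => f' y = Sum.inl i) = (univ.filter fun y => f y = i) \ R := by
    ext y
    simp only [mem_filter, mem_univ, true_and, mem_sdiff]
    by_cases hy : y ∈ R
    · rw [hR y hy]; simp [hy]
    · rw [hnR y hy]; simp [hy]
  rw [h5]
  split_ifs with hi
  · obtain ⟨x, hx, hxi⟩ := Finset.mem_image.1 hi
    have h6 : (univ.filter fun y => f y = i) \ R = (univ.filter fun y => f y = i).erase x := by
      ext y
      simp only [mem_filter, mem_univ, true_and, mem_sdiff, mem_erase]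
      constructor
      · rintro ⟨e1, e2⟩
        exact ⟨fun hc => e2 (hc ▸ hx), e1⟩
      · rintro ⟨e1, e2⟩
        refine ⟨e2, fun hc => e1 (hinj hc hx (e2.trans hxi.symm))⟩
    rw [h6, card_erase_of_mem (by simp [hxi]), mul_comm]
    apply Nat.mul_factorial_pred
    rw [← Nat.pos_iff_ne_zero]
    exact Finset.card_pos.2 ⟨x, by simp [hxi]⟩
  · have h6 : (univ.filter fun y => f y = i) \ R = (univ.filter fun y => f y = i) := by
      rw [Finset.sdiff_eq_self_iff_disjoint, Finset.disjoint_left]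
      intro y hy hyR
      apply hi
      simp only [mem_filter, mem_univ, true_and] at hy
      exact Finset.mem_image.2 ⟨y, hyR, hy⟩
    rw [h6, mul_one, fib]

lemma card_transversal (f : X → K) (E : Finset K) :
    #(univ.filter fun S : Finset X => Set.InjOn f S ∧ S.image f = E) = ∏ i ∈ E, fib f i := by
  unfold fib
  rw [← Finset.card_pi]
  symm
  refine Finset.card_bij (fun p _ => E.attach.image fun i => p i.1 i.2) ?_ ?_ ?_
  · intro p hp
    rw [Finset.mem_pi] at hp
    simp only [mem_filter, mem_univ, true_and] at hp ⊢
    constructor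
    · intro x hx y hy hxy
      simp only [coe_image, Set.mem_image, mem_coe, mem_attach, true_and, Subtype.exists] at hx hy
      obtain ⟨i, hi, rfl⟩ := hx
      obtain ⟨j, hj, rfl⟩ := hy
      rw [hp, hp] at hxy
      subst hxy
      rfl
    · ext i
      simp only [mem_image, mem_attach, true_and, Subtype.exists]
      constructor
      · rintro ⟨x, ⟨j, hj, rfl⟩, rfl⟩
        rw [hp]; exact hj
      · intro hi
        exact ⟨p i hi, ⟨i, hi, rfl⟩, hp i hi⟩
  · intro p hp q hq hpq
    rw [Finset.mem_pi] at hp hq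
    simp only [mem_filter, mem_univ, true_and] at hp hq
    funext i hi
    have : p i hi ∈ E.attach.image fun i => q i.1 i.2 := by
      rw [← hpq]
      exact Finset.mem_image.2 ⟨⟨i, hi⟩, by simp, rfl⟩
    simp only [mem_image, mem_attach, true_and, Subtype.exists] at this
    obtain ⟨j, hj, hj'⟩ := this
    have h2 : j = i := by
      rw [← hq j hj, hj', hp]
    subst h2
    exact hj'.symm
  · intro S hS
    simp only [mem_filter, mem_univ, true_and] at hS
    obtain ⟨hinj, rfl⟩ := hS
    have hex : ∀ i ∈ S.image f, ∃ x ∈ S, f x = i := fun i hi => Finset.mem_image.1 hi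
    choose p hp1 hp2 using hex
    refine ⟨p, ?_, ?_⟩
    · rw [Finset.mem_pi]
      intro i hi
      simp [hp2]
    · ext x
      simp only [mem_image, mem_attach, true_and, Subtype.exists]
      constructor
      · rintro ⟨i, hi, rfl⟩
        exact hp1 i _
      · intro hx
        exact ⟨f x, ⟨x, hx, rfl⟩, hinj (hp1 _ _) hx (hp2 _ _)⟩

lemma one_moved (f : X → K) (S : Finset X) :
    (#(univ.filter fun h : Equiv.Perm X => f ∘ h = f ∧ #(S.filter fun x => h x ≠ x) = 1) : ℚ) =
      ∑ a ∈ S, ((FR f (S.erase a) : ℚ) - FR f S) := by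
  have h1 : ∀ a ∈ S, (FR f (S.erase a) : ℚ) - FR f S =
      #(univ.filter fun h : Equiv.Perm X => f ∘ h = f ∧ (S.filter fun x => h x ≠ x) = {a}) := by
    intro a ha
    rw [sub_eq_iff_eq_add]
    unfold FR
    norm_cast
    rw [← Finset.card_union_of_disjoint]
    · congr 1
      ext h
      simp only [mem_filter, mem_univ, true_and, mem_union, mem_erase]
      constructor
      · rintro ⟨e1, e2⟩
        by_cases hha : h a = a
        · right
          refine ⟨e1, fun x hx => ?_⟩
          by_cases hxa : x = a
          · rw [hxa, hha]
          · exact e2 x ⟨hxa, hx⟩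
        · left
          refine ⟨e1, ?_⟩
          ext x
          simp only [mem_filter, mem_singleton]
          constructor
          · rintro ⟨e3, e4⟩
            by_contra hc
            exact e4 (e2 x ⟨hc, e3⟩)
          · rintro rfl
            exact ⟨ha, hha⟩
      · rintro (⟨e1, e2⟩ | ⟨e1, e2⟩)
        · refine ⟨e1, ?_⟩
          rintro x ⟨hxa, hx⟩
          by_contra hc
          have : x ∈ S.filter fun x => h x ≠ x := by simp [hx, hc]
          rw [e2, mem_singleton] at this
          exact hxa this
        · exact ⟨e1, fun x hx => e2 x hx.2⟩
    · rw [Finset.disjoint_left]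
      intro h hh hh'
      simp only [mem_filter, mem_univ, true_and] at hh hh'
      have : a ∈ S.filter fun x => h x ≠ x := by rw [hh.2]; simp
      rw [mem_filter] at this
      exact this.2 (hh'.2 a ha)
  rw [Finset.sum_congr rfl h1]
  norm_cast
  rw [← Finset.card_biUnion]
  · congr 1
    ext h
    simp only [mem_filter, mem_univ, true_and, mem_biUnion, card_eq_one]
    constructor
    · rintro ⟨e1, a, ha⟩
      refine ⟨a, ?_, e1, ha⟩
      have : a ∈ S.filter fun x => h x ≠ x := by rw [ha]; simp
      exact (mem_filter.1 this).1
    · rintro ⟨a, _, e1, ha⟩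
      exact ⟨e1, a, ha⟩
  · intro a _ b _ hab
    rw [Function.onFun, Finset.disjoint_left]
    intro h hh hh'
    simp only [mem_filter, mem_univ, true_and] at hh hh'
    rw [hh.2] at hh'
    exact hab (Finset.singleton_injective hh'.2)

lemma fib_pos (f : X → K) (x : X) : 0 < fib f (f x) :=
  Finset.card_pos.2 ⟨x, by simp⟩

lemma one_moved' (f : X → K) (S : Finset X) (hinj : Set.InjOn f S) :
    (#(univ.filter fun h : Equiv.Perm X => f ∘ h = f ∧ #(S.filter fun x => h x ≠ x) = 1) : ℚ) *
      ∏ i ∈ S.image f, (fib f i : ℚ) =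
      (∏ i, ((fib f i).factorial : ℚ)) * ∑ i ∈ S.image f, ((fib f i : ℚ) - 1) := by
  rw [one_moved, Finset.prod_image hinj, Finset.sum_image hinj, Finset.sum_mul, Finset.mul_sum]
  apply Finset.sum_congr rfl
  intro a ha
  have e1 : (FR f S : ℚ) * ∏ x ∈ S, (fib f (f x) : ℚ) = ∏ i, ((fib f i).factorial : ℚ) := by
    exact_mod_cast FR_mul f S hinj
  have e2 : (FR f (S.erase a) : ℚ) * ∏ x ∈ S.erase a, (fib f (f x) : ℚ) =
      ∏ i, ((fib f i).factorial : ℚ) := by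
    exact_mod_cast FR_mul f (S.erase a) (hinj.mono (by simp))
  have e3 := Finset.mul_prod_erase S (fun x => (fib f (f x) : ℚ)) ha
  rw [sub_mul, e1, ← e3]
  linear_combination (fib f (f a) : ℚ) * e2

lemma descSum (k : ℕ) : ∀ m, k ≤ m →
    (m + 1 - k) * ∑ j ∈ range (k + 1), k.choose j * (j.factorial * (m - j).factorial) =
      (m + 1).factorial := by
  induction k with
  | zero => intro m _; simp [Nat.factorial_succ]
  | succ k ih =>
    intro m hm
    obtain ⟨m, rfl⟩ : ∃ m', m = m' + 1 := ⟨m - 1, by omega⟩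
    have h1 := ih m (by omega)
    have e0 : m + 1 + 1 - (k + 1) = m + 1 - k := by omega
    have h2 : ∑ j ∈ range (k + 1 + 1), (k + 1).choose j * (j.factorial * (m + 1 - j).factorial) =
        (m + 1).factorial + (k + 1) *
          ∑ j ∈ range (k + 1), k.choose j * (j.factorial * (m - j).factorial) := by
      rw [Finset.sum_range_succ', add_comm, Finset.mul_sum]
      congr 1
      · simp
      · apply Finset.sum_congr rfl
        intro j _
        have e1 : m + 1 - (j + 1) = m - j := by omega
        have e2 := Nat.add_one_mul_choose_eq k j
        rw [e1, Nat.factorial_succ]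
        calc (k + 1).choose (j + 1) * ((j + 1) * j.factorial * (m - j).factorial)
            = ((k + 1).choose (j + 1) * (j + 1)) * (j.factorial * (m - j).factorial) := by ring
          _ = _ := by rw [← e2]; ring
    rw [e0, h2, mul_add, mul_left_comm, h1, Nat.factorial_succ (m + 1), ← add_mul]
    congr 1
    omega

end PartFour

section PartFive
variable {X : Type*} [Fintype X] [DecidableEq X] {K : Type*} [Fintype K] [DecidableEq K]

lemma sum_E (n : ℕ) (i : K) :
    ∑ E ∈ univ.filter (fun E : Finset K => i ∈ E), (#E - 1).factorial * (n - #E).factorial =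
    ∑ j ∈ range (Fintype.card K - 1 + 1),
      (Fintype.card K - 1).choose j * (j.factorial * (n - 1 - j).factorial) := by
  have h1 : #((univ : Finset K).erase i) = Fintype.card K - 1 := by
    rw [card_erase_of_mem (mem_univ _), card_univ]
  have h2 := Finset.sum_powerset_apply_card
    (fun j => j.factorial * (n - 1 - j).factorial) (x := (univ : Finset K).erase i)
  rw [h1] at h2
  simp only [smul_eq_mul] at h2
  rw [← h2]
  refine Finset.sum_bij' (fun E _ => E.erase i) (fun E _ => insert i E) ?_ ?_ ?_ ?_ ?_
  · intro E _
    rw [mem_powerset]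
    exact erase_subset_erase _ (subset_univ _)
  · intro E _; simp
  · intro E hE
    simp only [mem_filter, mem_univ, true_and] at hE
    exact insert_erase hE
  · intro E hE
    rw [mem_powerset] at hE
    apply erase_insert
    intro hc
    simpa using hE hc
  · intro E hE
    simp only [mem_filter, mem_univ, true_and] at hE
    rw [card_erase_of_mem hE]
    have := Finset.card_pos.2 ⟨i, hE⟩
    congr 2
    omega

lemma sum_S (f : X → K) (hf : ∀ i, 0 < fib f i) (W : ℕ → ℚ) :
    ∑ S ∈ univ.filter (fun S : Finset X => Set.InjOn f S), W #S *
      (#(univ.filter fun h : Equiv.Perm X => f ∘ h = f ∧ #(S.filter fun x => h x ≠ x) = 1) : ℚ) =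
    (∏ i, ((fib f i).factorial : ℚ)) * ∑ i, ((fib f i : ℚ) - 1) *
      ∑ E ∈ univ.filter (fun E : Finset K => i ∈ E), W #E := by
  have h1 : ∀ E : Finset K, ∑ S ∈ (univ.filter (fun S : Finset X => Set.InjOn f S)).filter
      (fun S => S.image f = E), W #S *
      (#(univ.filter fun h : Equiv.Perm X => f ∘ h = f ∧ #(S.filter fun x => h x ≠ x) = 1) : ℚ) =
      W #E * ((∏ i, ((fib f i).factorial : ℚ)) * ∑ i ∈ E, ((fib f i : ℚ) - 1)) := by
    intro E
    have hE : ∏ i ∈ E, (fib f i : ℚ) ≠ 0 := by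
      apply Finset.prod_ne_zero_iff.2
      intro i _
      exact_mod_cast (hf i).ne'
    rw [Finset.sum_congr rfl (g := fun _ => W #E *
      (((∏ i, ((fib f i).factorial : ℚ)) * ∑ i ∈ E, ((fib f i : ℚ) - 1)) /
        ∏ i ∈ E, (fib f i : ℚ)))]
    · rw [Finset.sum_const, Finset.filter_filter, card_transversal, nsmul_eq_mul]
      push_cast
      field_simp
    · intro S hS
      simp only [mem_filter, mem_univ, true_and] at hS
      obtain ⟨hinj, rfl⟩ := hS
      rw [card_image_of_injOn hinj]
      congr 1
      rw [eq_div_iff hE]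
      exact one_moved' f S hinj
  rw [← Finset.sum_fiberwise (univ.filter (fun S : Finset X => Set.InjOn f S))
    (fun S => S.image f)]
  rw [Finset.sum_congr rfl (fun E _ => h1 E)]
  have h2 : ∀ E : Finset K, W #E * ((∏ i, ((fib f i).factorial : ℚ)) *
      ∑ i ∈ E, ((fib f i : ℚ) - 1)) =
      ∑ i, (if i ∈ E then W #E * ((∏ i, ((fib f i).factorial : ℚ)) * ((fib f i : ℚ) - 1))
        else 0) := by
    intro E
    rw [Finset.sum_ite_mem, Finset.univ_inter, Finset.mul_sum, Finset.mul_sum]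
  rw [Finset.sum_congr rfl (fun E _ => h2 E), Finset.sum_comm, Finset.mul_sum]
  apply Finset.sum_congr rfl
  intro i _
  rw [Finset.mul_sum, Finset.mul_sum, Finset.sum_filter]
  apply Finset.sum_congr rfl
  intro E _
  split_ifs
  · ring
  · rfl

open Classical in
lemma core_sum (f : X → K) :
    (Fintype.card X : ℚ) * (#(univ.filter fun p : Equiv.Perm X × Equiv.Perm X =>
        Trn p.1 ∧ f ∘ p.2 = f ∧ Trn (p.1 * p.2)) : ℚ) =
      (Fintype.card X : ℚ) * #(univ.filter fun u : Equiv.Perm X => Trn u) *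
        #(univ.filter fun h : Equiv.Perm X => f ∘ h = f) -
      ∑ S ∈ univ.filter (fun S : Finset X => Set.InjOn f S),
      (((#S - 1).factorial * (Fintype.card X - #S).factorial : ℕ) : ℚ) *
      (#(univ.filter fun h : Equiv.Perm X => f ∘ h = f ∧ #(S.filter fun x => h x ≠ x) = 1) : ℚ) := by
  have h1 : (Fintype.card X : ℤ) * (#(univ.filter fun p : Equiv.Perm X × Equiv.Perm X =>
        Trn p.1 ∧ f ∘ p.2 = f ∧ Trn (p.1 * p.2)) : ℤ) =
      ∑ S : Finset X, ∑ h ∈ univ.filter (fun h : Equiv.Perm X => f ∘ h = f),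
        ((Fintype.card X : ℤ) - #S) *
        ∑ u ∈ univ.filter (fun u : Equiv.Perm X => Trn u), eS S (u * h) := by
    rw [Finset.sum_comm]
    simp_rw [Finset.mul_sum]
    rw [Finset.sum_congr rfl (fun h _ => Finset.sum_comm)]
    simp_rw [eS_sum]
    rw [Finset.card_filter]
    push_cast
    rw [Finset.mul_sum, Fintype.sum_prod_type, Finset.sum_comm, Finset.sum_filter]
    apply Finset.sum_congr rfl
    intro h _
    rw [Finset.sum_filter]
    split_ifs with hf
    · apply Finset.sum_congr rfl
      intro u _
      by_cases hu : Trn u <;> by_cases hv : Trn (u * h) <;> simp [hu, hv, hf]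
    · simp [hf]
  have h2 : ∀ S : Finset X, ∑ h ∈ univ.filter (fun h : Equiv.Perm X => f ∘ h = f),
        ((Fintype.card X : ℤ) - #S) *
        ∑ u ∈ univ.filter (fun u : Equiv.Perm X => Trn u), eS S (u * h) =
      (if S = ∅ then (Fintype.card X : ℤ) * #(univ.filter fun u : Equiv.Perm X => Trn u) *
        #(univ.filter fun h : Equiv.Perm X => f ∘ h = f) else 0) -
      if Set.InjOn f S then (((#S - 1).factorial * (Fintype.card X - #S).factorial : ℕ) : ℤ) *
      (#(univ.filter fun h : Equiv.Perm X => f ∘ h = f ∧ #(S.filter fun x => h x ≠ x) = 1) : ℤ)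
      else 0 := by
    intro S
    by_cases hS : S = ∅
    · subst hS
      simp [eS_empty]
      ring
    · rw [if_neg hS, zero_sub]
      split_ifs with hinj
      · rw [Finset.sum_congr rfl (fun h hh => G_eq (Finset.nonempty_iff_ne_empty.2 hS) hinj
          (mem_filter.1 hh).2)]
        rw [Finset.sum_neg_distrib, ← Finset.sum_filter, Finset.filter_filter, Finset.sum_const,
          nsmul_eq_mul, mul_comm]
      · rw [neg_zero]
        unfold Set.InjOn at hinj
        push Not at hinj
        obtain ⟨a, ha, b, hb, hfab, hab⟩ := hinj
        rw [mem_coe] at ha hb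
        have hsw : ∀ x, f (Equiv.swap a b x) = f x := by
          intro x
          rw [Equiv.swap_apply_def]
          split_ifs with e1 e2
          · rw [e1, hfab]
          · rw [e2, hfab]
          · rfl
        rw [← Finset.mul_sum]
        have : ∑ h ∈ univ.filter (fun h : Equiv.Perm X => f ∘ h = f),
            ∑ u ∈ univ.filter (fun u : Equiv.Perm X => Trn u), eS S (u * h) =
            ∑ h ∈ univ.filter (fun h : Equiv.Perm X => f ∘ h = f),
            - ∑ u ∈ univ.filter (fun u : Equiv.Perm X => Trn u), eS S (u * h) := by
          have hmem : ∀ h : Equiv.Perm X, h ∈ univ.filter (fun h : Equiv.Perm X => f ∘ h = f) →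
              h * Equiv.swap a b ∈ univ.filter (fun h : Equiv.Perm X => f ∘ h = f) := by
            intro h hh
            simp only [mem_filter, mem_univ, true_and] at hh ⊢
            funext x
            have := congrFun hh (Equiv.swap a b x)
            rw [Function.comp_apply] at this
            rw [Function.comp_apply, Equiv.Perm.mul_apply, this, hsw]
          refine Finset.sum_bij' (fun h _ => h * Equiv.swap a b) (fun h _ => h * Equiv.swap a b)
            hmem hmem ?_ ?_ ?_
          · intro h _; rw [mul_assoc, Equiv.swap_mul_self, mul_one]
          · intro h _; rw [mul_assoc, Equiv.swap_mul_self, mul_one]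
          · intro h _
            rw [← Finset.sum_neg_distrib]
            apply Finset.sum_congr rfl
            intro u _
            rw [← mul_assoc, eS_mul_swap _ ha hb hab, neg_neg]
        rw [Finset.sum_neg_distrib] at this
        have h0 : ∑ h ∈ univ.filter (fun h : Equiv.Perm X => f ∘ h = f),
            ∑ u ∈ univ.filter (fun u : Equiv.Perm X => Trn u), eS S (u * h) = 0 := by linarith
        rw [h0, mul_zero]
  rw [Finset.sum_congr rfl (fun S _ => h2 S), Finset.sum_sub_distrib, Finset.sum_ite_eq' ,
    if_pos (mem_univ _), ← Finset.sum_filter] at h1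
  exact_mod_cast h1

open Classical in
lemma core_count [Nonempty X] (f : X → K) (hf : ∀ i, 0 < fib f i) :
    (Fintype.card X + 1 - Fintype.card K) * #(univ.filter fun p : Equiv.Perm X × Equiv.Perm X =>
        Trn p.1 ∧ f ∘ p.2 = f ∧ Trn (p.1 * p.2)) =
      (Fintype.card X - 1).factorial * ∏ i, (fib f i).factorial := by
  have hn : 0 < Fintype.card X := Fintype.card_pos
  have hk : 0 < Fintype.card K := by
    obtain ⟨x⟩ : Nonempty X := inferInstance
    exact Fintype.card_pos_iff.2 ⟨f x⟩
  have hsum : ∑ i, fib f i = Fintype.card X := by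
    rw [← card_univ, Finset.card_eq_sum_card_fiberwise (f := f) (t := univ) (by simp)]
    rfl
  have hkn : Fintype.card K ≤ Fintype.card X := by
    rw [← hsum, ← card_univ, card_eq_sum_ones]
    exact Finset.sum_le_sum fun i _ => hf i
  have h1 := core_sum f
  rw [sum_S f hf (fun s => (((s - 1).factorial * (Fintype.card X - s).factorial : ℕ) : ℚ))] at h1
  have hD := descSum (Fintype.card K - 1) (Fintype.card X - 1) (by omega)
  have hE : ∀ i : K, ∑ E ∈ univ.filter (fun E : Finset K => i ∈ E),
      (((#E - 1).factorial * (Fintype.card X - #E).factorial : ℕ) : ℚ) =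
      ((∑ j ∈ range (Fintype.card K - 1 + 1),
      (Fintype.card K - 1).choose j * (j.factorial * (Fintype.card X - 1 - j).factorial) : ℕ) : ℚ) := by
    intro i
    rw [← sum_E]
    push_cast
    rfl
  simp_rw [hE] at h1
  have hH : #(univ.filter fun h : Equiv.Perm X => f ∘ h = f) = ∏ i, (fib f i).factorial := by
    have := FR_mul f ∅ (by simp)
    simpa [FR] using this
  have hC : #(univ.filter fun u : Equiv.Perm X => Trn u) = (Fintype.card X - 1).factorial := by
    rw [← card_trn X, Nat.card_eq_fintype_card, Fintype.card_subtype]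
  rw [hH, hC, ← Finset.sum_mul, Finset.sum_sub_distrib] at h1
  have hs' : ∑ i, (fib f i : ℚ) = Fintype.card X := by exact_mod_cast hsum
  rw [hs', Finset.sum_const, card_univ, nsmul_eq_mul, mul_one] at h1
  generalize (∑ j ∈ range (Fintype.card K - 1 + 1),
      (Fintype.card K - 1).choose j * (j.factorial * (Fintype.card X - 1 - j).factorial)) = D at *
  generalize #(univ.filter fun p : Equiv.Perm X × Equiv.Perm X =>
        Trn p.1 ∧ f ∘ p.2 = f ∧ Trn (p.1 * p.2)) = N at *
  generalize Fintype.card X = n at *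
  generalize Fintype.card K = k at *
  obtain ⟨m, rfl⟩ : ∃ m, n = m + 1 := ⟨n - 1, by omega⟩
  obtain ⟨d, hd⟩ : ∃ d, m + 1 = k + d := ⟨m + 1 - k, by omega⟩
  have e1 : m + 1 + 1 - k = d + 1 := by omega
  have e2 : m + 1 - 1 + 1 - (k - 1) = d + 1 := by omega
  rw [e2] at hD
  rw [e1]
  simp only [Nat.add_sub_cancel] at *
  have hD' : ((d : ℚ) + 1) * D = (m + 1) * (m.factorial : ℚ) := by
    rw [Nat.factorial_succ] at hD
    exact_mod_cast hD
  have hd' : (m : ℚ) + 1 = k + d := by exact_mod_cast hd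
  have hm : ((m : ℚ) + 1) ≠ 0 := by positivity
  have goal : ((d : ℚ) + 1) * N = (m.factorial : ℚ) * ((∏ i, (fib f i).factorial : ℕ) : ℚ) := by
    apply mul_left_cancel₀ hm
    push_cast at h1 ⊢
    have hmd : (m : ℚ) + 1 - k = d := by linarith
    rw [hmd] at h1
    linear_combination ((d : ℚ) + 1) * h1 - (∏ i, ((fib f i).factorial : ℚ)) * d * hD'
  exact_mod_cast goal

end PartFive

section PartSix

lemma exists_block (α : ℕ → ℕ) (x : ℕ) : ∀ k : ℕ, x < ∑ j ∈ range k, α j →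
    ∃ i < k, ∑ j ∈ range i, α j ≤ x ∧ x < ∑ j ∈ range (i + 1), α j := by
  intro k
  induction k with
  | zero => intro h; simp at h
  | succ k ih =>
    intro h
    by_cases hx : x < ∑ j ∈ range k, α j
    · obtain ⟨i, hi, h1⟩ := ih hx
      exact ⟨i, by omega, h1⟩
    · exact ⟨k, by omega, by omega, h⟩

lemma psum_mono (α : ℕ → ℕ) {i j : ℕ} (h : i ≤ j) :
    ∑ t ∈ range i, α t ≤ ∑ t ∈ range j, α t :=
  Finset.sum_le_sum_of_subset (Finset.range_mono h)

lemma block_unique (α : ℕ → ℕ) {x i j : ℕ}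
    (hi : ∑ t ∈ range i, α t ≤ x ∧ x < ∑ t ∈ range (i + 1), α t)
    (hj : ∑ t ∈ range j, α t ≤ x ∧ x < ∑ t ∈ range (j + 1), α t) : i = j := by
  rcases lt_trichotomy i j with h | h | h
  · have := psum_mono α (show i + 1 ≤ j from h)
    omega
  · exact h
  · have := psum_mono α (show j + 1 ≤ i from h)
    omega

lemma exists_blockfun (n k : ℕ) (α : ℕ → ℕ) (hsum : ∑ i ∈ range k, α i = n) :
    ∃ f : Fin n → Fin k, ∀ (x : Fin n) (i : Fin k), f x = i ↔
      (∑ j ∈ range (i : ℕ), α j ≤ (x : ℕ) ∧ (x : ℕ) < ∑ j ∈ range ((i : ℕ) + 1), α j) := by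
  have h := fun x : Fin n => exists_block α x k (by rw [hsum]; exact x.2)
  choose g hg hg2 using h
  refine ⟨fun x => ⟨g x, hg x⟩, fun x i => ⟨?_, ?_⟩⟩
  · rintro rfl
    exact hg2 x
  · intro hi
    exact Fin.ext (block_unique α (hg2 x) hi)

lemma blockfun_fib (n k : ℕ) (α : ℕ → ℕ) (hsum : ∑ i ∈ range k, α i = n) (f : Fin n → Fin k)
    (hf : ∀ (x : Fin n) (i : Fin k), f x = i ↔
      (∑ j ∈ range (i : ℕ), α j ≤ (x : ℕ) ∧ (x : ℕ) < ∑ j ∈ range ((i : ℕ) + 1), α j))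
    (i : Fin k) : fib f i = α i := by
  unfold fib
  have h1 : (univ.filter fun x => f x = i).map Fin.valEmbedding =
      Finset.Ico (∑ j ∈ range (i : ℕ), α j) (∑ j ∈ range ((i : ℕ) + 1), α j) := by
    ext y
    simp only [Finset.mem_map, mem_filter, mem_univ, true_and, Fin.valEmbedding_apply,
      Finset.mem_Ico]
    constructor
    · rintro ⟨x, hx, rfl⟩
      exact (hf x i).1 hx
    · intro hy
      have h2 := psum_mono α (show (i : ℕ) + 1 ≤ k from i.2)
      refine ⟨⟨y, by omega⟩, (hf _ i).2 hy, rfl⟩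
  rw [← Finset.card_map Fin.valEmbedding, h1, Nat.card_Ico, Finset.sum_range_succ]
  omega

lemma blockfun_sep (n k : ℕ) (α : ℕ → ℕ) (f : Fin n → Fin k)
    (hf : ∀ (x : Fin n) (i : Fin k), f x = i ↔
      (∑ j ∈ range (i : ℕ), α j ≤ (x : ℕ) ∧ (x : ℕ) < ∑ j ∈ range ((i : ℕ) + 1), α j))
    (σ : Equiv.Perm (Fin n)) : AlphaSeparated k α σ ↔ f ∘ σ = f := by
  constructor
  · intro h
    funext x
    obtain ⟨i, hi, h1, h2, h3, h4⟩ := h x (σ x) ⟨1, by simp⟩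
    have e1 := (hf x ⟨i, hi⟩).2 ⟨h1, h2⟩
    have e2 := (hf (σ x) ⟨i, hi⟩).2 ⟨h3, h4⟩
    rw [Function.comp_apply, e1, e2]
  · intro h x y hxy
    have hp : ∀ (m : ℕ) (z : Fin n), f ((σ ^ m) z) = f z := by
      intro m
      induction m with
      | zero => intro z; rfl
      | succ m ih =>
        intro z
        rw [pow_succ, Equiv.Perm.mul_apply, ih]
        exact congrFun h z
    obtain ⟨m, hm⟩ := hxy.exists_nat_pow_eq
    have e : f y = f x := by rw [← hm, hp]
    have h1 := (hf x (f x)).1 rfl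
    have h2 := (hf y (f x)).1 e
    exact ⟨f x, (f x).2, h1.1, h1.2, h2.1, h2.2⟩

lemma trn_inv_iff {X : Type*} (u : Equiv.Perm X) : Trn u⁻¹ ↔ Trn u := by
  unfold Trn
  simp only [Equiv.Perm.sameCycle_inv]

end PartSix

/-- For `n ≥ 1` and a composition `α = (α_1, …, α_k)` of `n` into `k`
positive parts, `(n+1-k)` times the number of ordered pairs `(u, v)` of `n`-cycles on
`[n]` whose product `u ∘ v` is `α`-separated equals `(n-1)! ⬝ ∏_{i=1}^{k} α_i!`. -/
theorem alpha_separated_pair_count (n k : ℕ) (α : ℕ → ℕ) (hn : 1 ≤ n) (hk : 1 ≤ k)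
    (hpos : ∀ i < k, 1 ≤ α i) (hsum : ∑ i ∈ Finset.range k, α i = n) :
    (n + 1 - k) *
      Nat.card {p : Equiv.Perm (Fin n) × Equiv.Perm (Fin n) //
        IsFullCycle p.1 ∧ IsFullCycle p.2 ∧ AlphaSeparated k α (p.1 * p.2)} =
    Nat.factorial (n - 1) * ∏ i ∈ Finset.range k, Nat.factorial (α i) := by

  classical
  obtain ⟨f, hf⟩ := exists_blockfun n k α hsum
  have hfib := blockfun_fib n k α hsum f hf
  haveI : Nonempty (Fin n) := ⟨⟨0, hn⟩⟩
  have hc := core_count f (fun i => by rw [hfib]; exact hpos i i.2)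
  rw [Fintype.card_fin, Fintype.card_fin] at hc
  simp only [hfib] at hc
  rw [← Fin.prod_univ_eq_prod_range (fun i => Nat.factorial (α i)) k, ← hc]
  congr 1
  rw [Nat.card_eq_fintype_card, Fintype.card_subtype]
  refine Finset.card_bij' (fun p _ => (p.1⁻¹, p.1 * p.2)) (fun p _ => (p.1⁻¹, p.1 * p.2))
    ?_ ?_ ?_ ?_
  · rintro ⟨u, v⟩ h
    simp only [mem_filter, mem_univ, true_and, isFullCycle_iff hn,
      blockfun_sep n k α f hf] at h ⊢
    refine ⟨(trn_inv_iff u).2 h.1, h.2.2, ?_⟩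
    rw [inv_mul_cancel_left]
    exact h.2.1
  · rintro ⟨u, v⟩ h
    simp only [mem_filter, mem_univ, true_and, isFullCycle_iff hn,
      blockfun_sep n k α f hf] at h ⊢
    refine ⟨(trn_inv_iff u).2 h.1, h.2.2, ?_⟩
    rw [inv_mul_cancel_left]
    exact h.2.1
  · rintro ⟨u, v⟩ _
    simp
  · rintro ⟨u, v⟩ _
    simp
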